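/- arXiv:1902.00791 — 13 statements merged into one kernel-verified Lean document; each statement's English description precedes it below -/
import Mathlib

section
/- Let C₁,…,C_K be bivariate copulas and let g_j^{(k)} : [0,1] → [0,1] (j ∈ {1,2}, k ∈ {1,…,K}) be monotone increasing functions with g_j^{(k)}(0) = 0 and g_j^{(k)}(1) = 1, satisfying the constraint ∏_{k=1}^K g_j^{(k)}(u) = u for all u ∈ [0,1] and j ∈ {1,2}. Then the function C̃(u,v) = ∏_{k=1}^K C_k(g_1^{(k)}(u), g_2^{(k)}(v)) is itself a bivariate copula: it satisfies C̃(u,0) = C̃(0,v) = 0, C̃(u,1) = u, C̃(1,v) = v for all u,v ∈ [0,1], and it is 2-increasing. -/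
open Set Filter

/-- A bivariate copula: maps `[0,1]²` into `[0,1]`, has the copula boundary conditions,
and is 2-increasing. -/
def IsCopula2 (C : ℝ → ℝ → ℝ) : Prop :=
  (∀ u ∈ Set.Icc (0:ℝ) 1, ∀ v ∈ Set.Icc (0:ℝ) 1, C u v ∈ Set.Icc (0:ℝ) 1) ∧
  (∀ u ∈ Set.Icc (0:ℝ) 1, C u 0 = 0) ∧
  (∀ v ∈ Set.Icc (0:ℝ) 1, C 0 v = 0) ∧
  (∀ u ∈ Set.Icc (0:ℝ) 1, C u 1 = u) ∧
  (∀ v ∈ Set.Icc (0:ℝ) 1, C 1 v = v) ∧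
  (∀ u₁ u₂ v₁ v₂ : ℝ, 0 ≤ u₁ → u₁ ≤ u₂ → u₂ ≤ 1 → 0 ≤ v₁ → v₁ ≤ v₂ → v₂ ≤ 1 →
    0 ≤ C u₂ v₂ - C u₂ v₁ - C u₁ v₂ + C u₁ v₁)

/-- The data of Liebscher's construction: bivariate copulas `C₁,…,C_K` together with
monotone increasing functions `g_j^{(k)} : [0,1] → [0,1]` (j = 1,2) with `g_j^{(k)}(0)=0`,
`g_j^{(k)}(1)=1` and `∏_k g_j^{(k)}(u) = u` on `[0,1]`. -/
structure LiebscherSetup (K : ℕ) where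
  C : Fin K → ℝ → ℝ → ℝ
  g₁ : Fin K → ℝ → ℝ
  g₂ : Fin K → ℝ → ℝ
  copula : ∀ k, IsCopula2 (C k)
  mono₁ : ∀ k, MonotoneOn (g₁ k) (Set.Icc 0 1)
  mono₂ : ∀ k, MonotoneOn (g₂ k) (Set.Icc 0 1)
  maps₁ : ∀ k, Set.MapsTo (g₁ k) (Set.Icc 0 1) (Set.Icc 0 1)
  maps₂ : ∀ k, Set.MapsTo (g₂ k) (Set.Icc 0 1) (Set.Icc 0 1)
  zero₁ : ∀ k, g₁ k 0 = 0
  zero₂ : ∀ k, g₂ k 0 = 0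
  one₁ : ∀ k, g₁ k 1 = 1
  one₂ : ∀ k, g₂ k 1 = 1
  prodId₁ : ∀ u ∈ Set.Icc (0:ℝ) 1, ∏ k, g₁ k u = u
  prodId₂ : ∀ u ∈ Set.Icc (0:ℝ) 1, ∏ k, g₂ k u = u

/-- The Liebscher copula `C̃(u,v) = ∏_k C_k(g₁^{(k)}(u), g₂^{(k)}(v))`. -/
def LiebscherSetup.Ct {K : ℕ} (L : LiebscherSetup K) (u v : ℝ) : ℝ :=
  ∏ k, L.C k (L.g₁ k u) (L.g₂ k v)

/-- A bivariate copula is nondecreasing in its first argument. -/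
lemma IsCopula2.mono_left {C : ℝ → ℝ → ℝ} (hC : IsCopula2 C) {u₁ u₂ v : ℝ}
    (hu₁ : 0 ≤ u₁) (hu : u₁ ≤ u₂) (hu₂ : u₂ ≤ 1) (hv₀ : 0 ≤ v) (hv₁ : v ≤ 1) :
    C u₁ v ≤ C u₂ v := by
  obtain ⟨-, hz, -, -, -, hinc⟩ := hC
  have := hinc u₁ u₂ 0 v hu₁ hu hu₂ le_rfl hv₀ hv₁
  rw [hz u₁ ⟨hu₁, hu.trans hu₂⟩, hz u₂ ⟨hu₁.trans hu, hu₂⟩] at this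
  linarith

/-- A bivariate copula is nondecreasing in its second argument. -/
lemma IsCopula2.mono_right {C : ℝ → ℝ → ℝ} (hC : IsCopula2 C) {u v₁ v₂ : ℝ}
    (hu₀ : 0 ≤ u) (hu₁ : u ≤ 1) (hv₁ : 0 ≤ v₁) (hv : v₁ ≤ v₂) (hv₂ : v₂ ≤ 1) :
    C u v₁ ≤ C u v₂ := by
  obtain ⟨-, -, hz, -, -, hinc⟩ := hC
  have := hinc 0 u v₁ v₂ le_rfl hu₀ hu₁ hv₁ hv hv₂
  rw [hz v₁ ⟨hv₁, hv.trans hv₂⟩, hz v₂ ⟨hv₁.trans hv, hv₂⟩] at this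
  linarith

/-- Products of nonnegative, nondecreasing, supermodular functions on the four corners of a
rectangle are supermodular. -/
lemma prod_add_prod_le_prod_add_prod {ι : Type*} (s : Finset ι) (a b c d : ι → ℝ)
    (ha : ∀ i ∈ s, 0 ≤ a i) (hab : ∀ i ∈ s, a i ≤ b i) (hac : ∀ i ∈ s, a i ≤ c i)
    (hsum : ∀ i ∈ s, b i + c i ≤ a i + d i) :
    ∏ i ∈ s, b i + ∏ i ∈ s, c i ≤ ∏ i ∈ s, a i + ∏ i ∈ s, d i := by
  induction s using Finset.cons_induction with
  | empty => simp
  | cons i s hi ih =>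
    simp only [Finset.mem_cons, forall_eq_or_imp] at ha hab hac hsum
    have hA := Finset.prod_nonneg ha.2
    have hAB := Finset.prod_le_prod ha.2 hab.2
    have hAC := Finset.prod_le_prod ha.2 hac.2
    have hS := ih ha.2 hab.2 hac.2 hsum.2
    simp only [Finset.prod_cons]
    have hb := ha.1.trans hab.1
    have hc := ha.1.trans hac.1
    have hd : 0 ≤ d i := by linarith [hab.1, hsum.1, hc]
    generalize ∏ i ∈ s, a i = A at *
    generalize ∏ i ∈ s, b i = B at *
    generalize ∏ i ∈ s, c i = C at *
    generalize ∏ i ∈ s, d i = D at *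
    have h₁ := mul_le_mul_of_nonneg_left hS hd
    have h₂ := mul_le_mul_of_nonneg_right hsum.1 (by linarith : 0 ≤ B + C - A)
    have h₃ := mul_nonneg (sub_nonneg.2 hab.1) (sub_nonneg.2 hAC)
    have h₄ := mul_nonneg (sub_nonneg.2 hac.1) (sub_nonneg.2 hAB)
    linarith

/-- **Liebscher's theorem (bivariate case).** The combination
`C̃(u,v) = ∏_k C_k(g₁^{(k)}(u), g₂^{(k)}(v))` of bivariate copulas via monotone increasing
functions with `g_j^{(k)}(0)=0`, `g_j^{(k)}(1)=1` and `∏_k g_j^{(k)}(u)=u` is itself a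
bivariate copula. -/
theorem liebscher_combination_is_copula (K : ℕ) (hK : 1 ≤ K) (L : LiebscherSetup K) :
    IsCopula2 L.Ct := by
  let k₀ : Fin K := ⟨0, hK⟩
  refine ⟨fun u hu v hv => ⟨?_, ?_⟩, fun u hu => ?_, fun v hv => ?_, fun u hu => ?_,
    fun v hv => ?_, fun u₁ u₂ v₁ v₂ hu₁ hu hu₂ hv₁ hv hv₂ => ?_⟩
  · exact Finset.prod_nonneg fun k _ => ((L.copula k).1 _ (L.maps₁ k hu) _ (L.maps₂ k hv)).1
  · exact Finset.prod_le_one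
      (fun k _ => ((L.copula k).1 _ (L.maps₁ k hu) _ (L.maps₂ k hv)).1)
      (fun k _ => ((L.copula k).1 _ (L.maps₁ k hu) _ (L.maps₂ k hv)).2)
  · refine Finset.prod_eq_zero (Finset.mem_univ k₀) ?_
    rw [L.zero₂]
    exact (L.copula k₀).2.1 _ (L.maps₁ k₀ hu)
  · refine Finset.prod_eq_zero (Finset.mem_univ k₀) ?_
    rw [L.zero₁]
    exact (L.copula k₀).2.2.1 _ (L.maps₂ k₀ hv)
  · refine (Finset.prod_congr rfl fun k _ => ?_).trans (L.prodId₁ u hu)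
    rw [L.one₂]
    exact (L.copula k).2.2.2.1 _ (L.maps₁ k hu)
  · refine (Finset.prod_congr rfl fun k _ => ?_).trans (L.prodId₂ v hv)
    rw [L.one₁]
    exact (L.copula k).2.2.2.2.1 _ (L.maps₂ k hv)
  · have mu₁ : u₁ ∈ Set.Icc (0:ℝ) 1 := ⟨hu₁, hu.trans hu₂⟩
    have mu₂ : u₂ ∈ Set.Icc (0:ℝ) 1 := ⟨hu₁.trans hu, hu₂⟩
    have mv₁ : v₁ ∈ Set.Icc (0:ℝ) 1 := ⟨hv₁, hv.trans hv₂⟩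
    have mv₂ : v₂ ∈ Set.Icc (0:ℝ) 1 := ⟨hv₁.trans hv, hv₂⟩
    have key := prod_add_prod_le_prod_add_prod Finset.univ
      (fun k => L.C k (L.g₁ k u₁) (L.g₂ k v₁)) (fun k => L.C k (L.g₁ k u₂) (L.g₂ k v₁))
      (fun k => L.C k (L.g₁ k u₁) (L.g₂ k v₂)) (fun k => L.C k (L.g₁ k u₂) (L.g₂ k v₂))
      (fun k _ => ((L.copula k).1 _ (L.maps₁ k mu₁) _ (L.maps₂ k mv₁)).1)
      (fun k _ => (L.copula k).mono_left (L.maps₁ k mu₁).1 (L.mono₁ k mu₁ mu₂ hu)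
        (L.maps₁ k mu₂).2 (L.maps₂ k mv₁).1 (L.maps₂ k mv₁).2)
      (fun k _ => (L.copula k).mono_right (L.maps₁ k mu₁).1 (L.maps₁ k mu₁).2
        (L.maps₂ k mv₁).1 (L.mono₂ k mv₁ mv₂ hv) (L.maps₂ k mv₂).2)
      (fun k _ => by
        have := (L.copula k).2.2.2.2.2 _ _ _ _ (L.maps₁ k mu₁).1 (L.mono₁ k mu₁ mu₂ hu)
          (L.maps₁ k mu₂).2 (L.maps₂ k mv₁).1 (L.mono₂ k mv₁ mv₂ hv) (L.maps₂ k mv₂).2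
        linarith)
    simp only [LiebscherSetup.Ct]
    linarith
end

section
/- Consider the Liebscher copula C̃ built from bivariate copulas C₁,…,C_K with g_1^{(k)} = g_2^{(k)} =: g^{(k)} for every k, where each g^{(k)} satisfies g^{(k)}(t) > 0 for t ∈ (0,1] and is regularly varying at 0 with index γ^{(k)} > 0, i.e. g^{(k)}(εt)/g^{(k)}(ε) → t^{γ^{(k)}} as ε → 0⁺ for every t > 0. Assume moreover that for each k the lower tail dependence function Λ_k(x,y) := lim_{ε→0⁺} C_k(εx, εy)/ε exists for all x, y > 0. Then necessarily ∑_{k=1}^K γ^{(k)} = 1, and for all x, y > 0 the limit lim_{ε→0⁺} C̃(εx, εy)/ε exists and equals ∏_{k=1}^K Λ_k(x^{γ^{(k)}}, y^{γ^{(k)}}). -/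
open Set Filter

/-- A bivariate copula is `1`-Lipschitz in its first argument. -/
lemma IsCopula2.abs_sub_left_le {C : ℝ → ℝ → ℝ} (hC : IsCopula2 C) {u u' v : ℝ}
    (hu : u ∈ Set.Icc (0 : ℝ) 1) (hu' : u' ∈ Set.Icc (0 : ℝ) 1) (hv : v ∈ Set.Icc (0 : ℝ) 1) :
    |C u v - C u' v| ≤ |u - u'| := by
  obtain ⟨-, h0, -, h1, -, hinc⟩ := hC
  wlog h : u' ≤ u generalizing u u'
  · rw [abs_sub_comm (C u v), abs_sub_comm u]
    exact this hu' hu (le_of_not_ge h)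
  have hlow := hinc u' u 0 v hu'.1 h hu.2 le_rfl hv.1 hv.2
  have hupp := hinc u' u v 1 hu'.1 h hu.2 hv.1 hv.2 le_rfl
  rw [h0 u hu, h0 u' hu'] at hlow
  rw [h1 u hu, h1 u' hu'] at hupp
  rw [abs_of_nonneg (by linarith), abs_of_nonneg (by linarith)]
  linarith

lemma IsCopula2.swap {C : ℝ → ℝ → ℝ} (hC : IsCopula2 C) : IsCopula2 fun u v => C v u := by
  obtain ⟨hm, h0, h0', h1, h1', hinc⟩ := hC
  refine ⟨fun u hu v hv => hm v hv u hu, h0', h0, h1', h1, ?_⟩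
  intro u₁ u₂ v₁ v₂ a b c d e f
  have := hinc v₁ v₂ u₁ u₂ d e f a b c
  linarith

/-- A bivariate copula is `1`-Lipschitz with respect to the `ℓ¹` norm. -/
lemma IsCopula2.abs_sub_le {C : ℝ → ℝ → ℝ} (hC : IsCopula2 C) {u u' v v' : ℝ}
    (hu : u ∈ Set.Icc (0 : ℝ) 1) (hu' : u' ∈ Set.Icc (0 : ℝ) 1)
    (hv : v ∈ Set.Icc (0 : ℝ) 1) (hv' : v' ∈ Set.Icc (0 : ℝ) 1) :
    |C u v - C u' v'| ≤ |u - u'| + |v - v'| :=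
  (_root_.abs_sub_le _ (C u' v) _).trans
    (add_le_add (hC.abs_sub_left_le hu hu' hv) (hC.swap.abs_sub_left_le hv hv' hu'))

lemma eventually_mul_mem_Ioc_zero_one {x : ℝ} (hx : 0 < x) :
    ∀ᶠ ε in nhdsWithin (0 : ℝ) (Set.Ioi 0), ε * x ∈ Set.Ioc (0 : ℝ) 1 := by
  filter_upwards [Ioo_mem_nhdsGT (inv_pos.2 hx)] with ε hε
  refine ⟨mul_pos hε.1 hx, ?_⟩
  have := mul_le_mul_of_nonneg_right hε.2.le hx.le
  rwa [inv_mul_cancel₀ hx.ne'] at this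

/-- A monotone function on `[0, 1]` that is positive on `(0, 1]` and regularly varying at `0` with
positive index tends to `0` from above at `0`. -/
lemma tendsto_nhdsGT_zero_of_regularlyVarying {g : ℝ → ℝ} {γ : ℝ} (hγ : 0 < γ)
    (hmono : MonotoneOn g (Set.Icc 0 1)) (hpos : ∀ t ∈ Set.Ioc (0 : ℝ) 1, 0 < g t)
    (hRV : Filter.Tendsto (fun ε => g (ε * 2) / g ε) (nhdsWithin 0 (Set.Ioi 0))
      (nhds (2 ^ γ))) :
    Filter.Tendsto g (nhdsWithin 0 (Set.Ioi 0)) (nhdsWithin 0 (Set.Ioi 0)) := by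
  have hevpos : ∀ᶠ ε in nhdsWithin (0 : ℝ) (Set.Ioi 0), 0 < g ε := by
    filter_upwards [Ioc_mem_nhdsGT (zero_lt_one' ℝ)] with ε hε using hpos ε hε
  have hlim : ∃ l, Filter.Tendsto g (nhdsWithin 0 (Set.Ioi 0)) (nhds l) := by
    refine ⟨_, MonotoneOn.tendsto_nhdsWithin_Ioo_right (y := 1) (by simp)
      (hmono.mono Set.Ioo_subset_Icc_self) ⟨0, ?_⟩⟩
    rintro _ ⟨t, ht, rfl⟩
    exact (hpos t (Set.Ioo_subset_Ioc_self ht)).le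
  obtain ⟨l, hl⟩ := hlim
  have hl0 : l = 0 := by
    by_contra hne
    have hdouble : Filter.Tendsto (fun ε : ℝ => ε * 2) (nhdsWithin 0 (Set.Ioi 0))
        (nhdsWithin 0 (Set.Ioi 0)) := by
      refine tendsto_nhdsWithin_iff.2 ⟨?_, ?_⟩
      · have : Filter.Tendsto (fun ε : ℝ => ε * 2) (nhds 0) (nhds (0 * 2)) :=
          (continuous_id.mul continuous_const).tendsto 0
        rw [zero_mul] at this
        exact this.mono_left nhdsWithin_le_nhds
      · filter_upwards [self_mem_nhdsWithin] with ε hε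
        exact mul_pos (Set.mem_Ioi.1 hε) two_pos
    have heq := tendsto_nhds_unique ((hl.comp hdouble).div hl hne) hRV
    rw [div_self hne] at heq
    exact (Real.one_lt_rpow one_lt_two hγ).ne heq
  exact tendsto_nhdsWithin_iff.2 ⟨hl0 ▸ hl, hevpos⟩

/-- The lower tail limit of a copula may be taken along arguments that are only asymptotically
proportional to the scale `δ → 0⁺`. -/
lemma IsCopula2.tendsto_lowerTail_of_asymptotic {C : ℝ → ℝ → ℝ} (hC : IsCopula2 C)
    {α : Type*} {F : Filter α} {δ u v : α → ℝ} {a b l : ℝ} (ha : 0 < a) (hb : 0 < b)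
    (hl : Filter.Tendsto (fun ε => C (ε * a) (ε * b) / ε) (nhdsWithin 0 (Set.Ioi 0)) (nhds l))
    (hδ : Filter.Tendsto δ F (nhdsWithin 0 (Set.Ioi 0)))
    (hu : Filter.Tendsto (fun i => u i / δ i) F (nhds a))
    (hv : Filter.Tendsto (fun i => v i / δ i) F (nhds b))
    (hu01 : ∀ᶠ i in F, u i ∈ Set.Icc (0 : ℝ) 1) (hv01 : ∀ᶠ i in F, v i ∈ Set.Icc (0 : ℝ) 1) :
    Filter.Tendsto (fun i => C (u i) (v i) / δ i) F (nhds l) := by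
  have hbound : Filter.Tendsto (fun i => |u i / δ i - a| + |v i / δ i - b|) F (nhds 0) := by
    simpa using (hu.sub_const a).abs.add (hv.sub_const b).abs
  have hdiff : Filter.Tendsto
      (fun i => C (u i) (v i) / δ i - C (δ i * a) (δ i * b) / δ i) F (nhds 0) := by
    refine squeeze_zero_norm' ?_ hbound
    filter_upwards [hu01, hv01, hδ.eventually self_mem_nhdsWithin,
      hδ.eventually (eventually_mul_mem_Ioc_zero_one ha),
      hδ.eventually (eventually_mul_mem_Ioc_zero_one hb)] with i hui hvi hi hai hbi
    have hi : 0 < δ i := hi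
    have hscale : ∀ w c : ℝ, |w / δ i - c| = |w - δ i * c| / δ i := by
      intro w c
      rw [show w / δ i - c = (w - δ i * c) / δ i by field_simp, abs_div, abs_of_pos hi]
    rw [Real.norm_eq_abs, ← sub_div, abs_div, abs_of_pos hi, hscale, hscale, ← add_div]
    gcongr
    exact hC.abs_sub_le hui (Set.Ioc_subset_Icc_self hai) hvi (Set.Ioc_subset_Icc_self hbi)
  simpa using hdiff.add (hl.comp hδ)

/-- **Lower tail dependence function of a Liebscher copula, symmetric case.**
If `g₁^{(k)} = g₂^{(k)} = g^{(k)}` is positive on `(0,1]` and regularly varying at 0 with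
index `γ^{(k)} > 0`, and each `C_k` admits a lower tail dependence function `Λ_k`, then
`∑_k γ^{(k)} = 1` and the lower tail dependence function of `C̃` is
`(x,y) ↦ ∏_k Λ_k(x^{γ^{(k)}}, y^{γ^{(k)}})`. -/
theorem liebscher_lower_tail_symmetric (K : ℕ) (hK : 1 ≤ K) (L : LiebscherSetup K)
    (g : Fin K → ℝ → ℝ) (hg₁ : ∀ k, L.g₁ k = g k) (hg₂ : ∀ k, L.g₂ k = g k)
    (γ : Fin K → ℝ) (hγ : ∀ k, 0 < γ k)
    (hgpos : ∀ k, ∀ t ∈ Set.Ioc (0:ℝ) 1, 0 < g k t)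
    (hRV : ∀ k, ∀ t > (0:ℝ),
      Filter.Tendsto (fun ε => g k (ε * t) / g k ε) (nhdsWithin 0 (Set.Ioi 0))
        (nhds (t ^ γ k)))
    (Λ : Fin K → ℝ → ℝ → ℝ)
    (hΛ : ∀ k, ∀ x > (0:ℝ), ∀ y > (0:ℝ),
      Filter.Tendsto (fun ε => L.C k (ε * x) (ε * y) / ε) (nhdsWithin 0 (Set.Ioi 0))
        (nhds (Λ k x y))) :
    (∑ k, γ k = 1) ∧
    ∀ x > (0:ℝ), ∀ y > (0:ℝ),
      Filter.Tendsto (fun ε => L.Ct (ε * x) (ε * y) / ε) (nhdsWithin 0 (Set.Ioi 0))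
        (nhds (∏ k, Λ k (x ^ γ k) (y ^ γ k))) := by
  have hprod : ∀ t ∈ Set.Icc (0 : ℝ) 1, ∏ k, g k t = t := fun t ht => by
    simpa only [hg₁] using L.prodId₁ t ht
  have hmaps : ∀ k, ∀ t ∈ Set.Ioc (0 : ℝ) 1, g k t ∈ Set.Icc (0 : ℝ) 1 := fun k t ht =>
    hg₁ k ▸ L.maps₁ k (Set.Ioc_subset_Icc_self ht)
  have hunit : ∀ᶠ ε in nhdsWithin (0 : ℝ) (Set.Ioi 0), ε ∈ Set.Ioc (0 : ℝ) 1 :=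
    Ioc_mem_nhdsGT zero_lt_one
  refine ⟨?_, fun x hx y hy => ?_⟩
  · have hlim := tendsto_finsetProd Finset.univ fun k _ => hRV k 2 two_pos
    have hconst : Filter.Tendsto (fun ε => ∏ k, g k (ε * 2) / g k ε)
        (nhdsWithin 0 (Set.Ioi 0)) (nhds 2) := by
      refine tendsto_const_nhds.congr' ?_
      filter_upwards [hunit, eventually_mul_mem_Ioc_zero_one (two_pos (α := ℝ))] with ε hε hε2
      rw [Finset.prod_div_distrib, hprod _ (Set.Ioc_subset_Icc_self hε2),
        hprod _ (Set.Ioc_subset_Icc_self hε), mul_div_cancel_left₀ _ hε.1.ne']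
    have heq := tendsto_nhds_unique hlim hconst
    rw [← Real.rpow_sum_of_pos two_pos] at heq
    exact (Real.rpow_right_inj two_pos (by norm_num)).1 (heq.trans (Real.rpow_one 2).symm)
  · have hfactor : ∀ k, Filter.Tendsto (fun ε => L.C k (g k (ε * x)) (g k (ε * y)) / g k ε)
        (nhdsWithin 0 (Set.Ioi 0)) (nhds (Λ k (x ^ γ k) (y ^ γ k))) := by
      intro k
      have hxγ := Real.rpow_pos_of_pos hx (γ k)
      have hyγ := Real.rpow_pos_of_pos hy (γ k)
      exact (L.copula k).tendsto_lowerTail_of_asymptotic hxγ hyγ (hΛ k _ hxγ _ hyγ)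
        (tendsto_nhdsGT_zero_of_regularlyVarying (hγ k) (hg₁ k ▸ L.mono₁ k) (hgpos k)
          (hRV k 2 two_pos))
        (hRV k x hx) (hRV k y hy)
        ((eventually_mul_mem_Ioc_zero_one hx).mono fun ε hε => hmaps k _ hε)
        ((eventually_mul_mem_Ioc_zero_one hy).mono fun ε hε => hmaps k _ hε)
    refine (tendsto_finsetProd Finset.univ fun k _ => hfactor k).congr' ?_
    filter_upwards [hunit] with ε hε
    rw [Finset.prod_div_distrib, hprod _ (Set.Ioc_subset_Icc_self hε)]
    simp only [LiebscherSetup.Ct, hg₁, hg₂]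
end

section
/- Consider the Liebscher copula C̃ built from bivariate copulas C₁,…,C_K. Suppose there exists k₀ ∈ {1,…,K} such that g_2^{(k₀)}(ε) > 0 for all ε ∈ (0,1] and g_1^{(k₀)}(ε)/g_2^{(k₀)}(ε) → 0 as ε → 0⁺. Then for all x, y > 0, C̃(εx, εy)/ε → 0 as ε → 0⁺; i.e., the lower tail dependence function of C̃ is identically zero. -/
open Set Filter

/-- A copula is bounded above by its first argument. -/
theorem IsCopula2.le_left {C : ℝ → ℝ → ℝ} (hC : IsCopula2 C) {u v : ℝ}
    (hu : u ∈ Set.Icc (0:ℝ) 1) (hv : v ∈ Set.Icc (0:ℝ) 1) : C u v ≤ u := by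
  obtain ⟨-, -, h0, h1, -, h⟩ := hC
  have := h 0 u v 1 le_rfl hu.1 hu.2 hv.1 hv.2 le_rfl
  rw [h1 u hu, h0 1 (by simp), h0 v hv] at this
  linarith

/-- A copula is bounded above by its second argument. -/
theorem IsCopula2.le_right {C : ℝ → ℝ → ℝ} (hC : IsCopula2 C) {u v : ℝ}
    (hu : u ∈ Set.Icc (0:ℝ) 1) (hv : v ∈ Set.Icc (0:ℝ) 1) : C u v ≤ v := by
  obtain ⟨-, h0, -, -, h1, h⟩ := hC
  have := h u 1 0 v hu.1 hu.2 le_rfl le_rfl hv.1 hv.2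
  rw [h1 v hv, h0 1 (by simp), h0 u hu] at this
  linarith

theorem LiebscherSetup.Ct_nonneg {K : ℕ} (L : LiebscherSetup K) {u v : ℝ}
    (hu : u ∈ Set.Icc (0:ℝ) 1) (hv : v ∈ Set.Icc (0:ℝ) 1) : 0 ≤ L.Ct u v :=
  Finset.prod_nonneg fun k _ => ((L.copula k).1 _ (L.maps₁ k hu) _ (L.maps₂ k hv)).1

/-- Bounding the `k₀`-th factor by its first argument and all the others by their second
argument bounds the Liebscher copula by the ratio of the `k₀`-th distortions. -/
theorem LiebscherSetup.Ct_le_ratio_mul {K : ℕ} (L : LiebscherSetup K) (k₀ : Fin K) {u v w : ℝ}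
    (hu : u ∈ Set.Icc (0:ℝ) 1) (hv : v ∈ Set.Icc (0:ℝ) 1) (hw : w ∈ Set.Icc (0:ℝ) 1)
    (huw : u ≤ w) (hvw : v ≤ w) (hpos : 0 < L.g₂ k₀ w) :
    L.Ct u v ≤ L.g₁ k₀ w / L.g₂ k₀ w * w := by
  have hnn : ∀ k, 0 ≤ L.C k (L.g₁ k u) (L.g₂ k v) := fun k =>
    ((L.copula k).1 _ (L.maps₁ k hu) _ (L.maps₂ k hv)).1
  have hfst : L.C k₀ (L.g₁ k₀ u) (L.g₂ k₀ v) ≤ L.g₁ k₀ w :=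
    ((L.copula k₀).le_left (L.maps₁ k₀ hu) (L.maps₂ k₀ hv)).trans (L.mono₁ k₀ hu hw huw)
  have hrest : ∏ k ∈ Finset.univ.erase k₀, L.C k (L.g₁ k u) (L.g₂ k v) ≤
      ∏ k ∈ Finset.univ.erase k₀, L.g₂ k w :=
    Finset.prod_le_prod (fun k _ => hnn k) fun k _ =>
      ((L.copula k).le_right (L.maps₁ k hu) (L.maps₂ k hv)).trans (L.mono₂ k hv hw hvw)
  have hprod : L.g₂ k₀ w * ∏ k ∈ Finset.univ.erase k₀, L.g₂ k w = w := by
    rw [Finset.mul_prod_erase _ (fun k => L.g₂ k w) (Finset.mem_univ k₀), L.prodId₂ w hw]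
  calc L.Ct u v
      = L.C k₀ (L.g₁ k₀ u) (L.g₂ k₀ v) *
          ∏ k ∈ Finset.univ.erase k₀, L.C k (L.g₁ k u) (L.g₂ k v) :=
        (Finset.mul_prod_erase _ (fun k => L.C k (L.g₁ k u) (L.g₂ k v))
          (Finset.mem_univ k₀)).symm
    _ ≤ L.g₁ k₀ w * ∏ k ∈ Finset.univ.erase k₀, L.g₂ k w :=
        mul_le_mul hfst hrest (Finset.prod_nonneg fun k _ => hnn k) (L.maps₁ k₀ hw).1
    _ = L.g₁ k₀ w / L.g₂ k₀ w *
          (L.g₂ k₀ w * ∏ k ∈ Finset.univ.erase k₀, L.g₂ k w) := by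
        field_simp
    _ = L.g₁ k₀ w / L.g₂ k₀ w * w := by rw [hprod]

/-- **Lower tail dependence function of a Liebscher copula, asymmetric case.**
If for some `k₀` one has `g₂^{(k₀)} > 0` on `(0,1]` and
`g₁^{(k₀)}(ε)/g₂^{(k₀)}(ε) → 0` as `ε → 0⁺`, then the lower tail dependence function of
the Liebscher copula `C̃` is identically zero. -/
theorem liebscher_lower_tail_asymmetric (K : ℕ) (hK : 1 ≤ K) (L : LiebscherSetup K)
    (k₀ : Fin K)
    (hpos : ∀ ε ∈ Set.Ioc (0:ℝ) 1, 0 < L.g₂ k₀ ε)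
    (hratio : Filter.Tendsto (fun ε => L.g₁ k₀ ε / L.g₂ k₀ ε)
      (nhdsWithin 0 (Set.Ioi 0)) (nhds 0)) :
    ∀ x > (0:ℝ), ∀ y > (0:ℝ),
      Filter.Tendsto (fun ε => L.Ct (ε * x) (ε * y) / ε)
        (nhdsWithin 0 (Set.Ioi 0)) (nhds 0) := by
  intro x hx y hy
  set m := max x y
  have hm : 0 < m := lt_max_of_lt_left hx
  have hscale : Tendsto (fun ε : ℝ => ε * m) (nhdsWithin 0 (Set.Ioi 0))
      (nhdsWithin 0 (Set.Ioi 0)) := by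
    refine tendsto_nhdsWithin_iff.2 ⟨?_, ?_⟩
    · have : Tendsto (fun ε : ℝ => ε * m) (nhds 0) (nhds (0 * m)) :=
        tendsto_id.mul_const m
      rw [zero_mul] at this
      exact this.mono_left nhdsWithin_le_nhds
    · filter_upwards [self_mem_nhdsWithin] with ε hε
      exact mul_pos hε hm
  have hbound := (hratio.comp hscale).mul_const m
  rw [zero_mul] at hbound
  have hmem : ∀ᶠ ε : ℝ in nhdsWithin 0 (Set.Ioi 0), 0 < ε ∧ ε * m ∈ Set.Ioc (0:ℝ) 1 :=
    (eventually_mem_nhdsWithin).and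
      (hscale.eventually (Ioc_mem_nhdsGT zero_lt_one))
  have hargs : ∀ ε : ℝ, 0 < ε → ε * m ≤ 1 → ∀ z : ℝ, 0 < z → z ≤ m →
      ε * z ∈ Set.Icc (0:ℝ) 1 := fun ε hε h1 z hz hzm =>
    ⟨(mul_pos hε hz).le, (mul_le_mul_of_nonneg_left hzm hε.le).trans h1⟩
  refine squeeze_zero' ?_ ?_ hbound
  · filter_upwards [hmem] with ε ⟨hε, hεm⟩
    exact div_nonneg (L.Ct_nonneg (hargs ε hε hεm.2 x hx (le_max_left x y))
      (hargs ε hε hεm.2 y hy (le_max_right x y))) hε.le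
  · filter_upwards [hmem] with ε ⟨hε, hεm⟩
    rw [div_le_iff₀ hε]
    refine (L.Ct_le_ratio_mul k₀ (hargs ε hε hεm.2 x hx (le_max_left x y))
      (hargs ε hε hεm.2 y hy (le_max_right x y)) ⟨hεm.1.le, hεm.2⟩
      (mul_le_mul_of_nonneg_left (le_max_left x y) hε.le)
      (mul_le_mul_of_nonneg_left (le_max_right x y) hε.le) (hpos _ hεm)).trans_eq ?_
    simp only [Function.comp_apply]
    ring
end

section
/- Consider the Liebscher copula C̃ built from bivariate copulas C₁,…,C_K with g_1^{(k)} = g_2^{(k)} =: g^{(k)} for every k, where each g^{(k)} satisfies g^{(k)}(t) > 0 for t ∈ (0,1] and g^{(k)}(εt)/g^{(k)}(ε) → t^{γ^{(k)}} as ε → 0⁺ for every t > 0, with γ^{(k)} > 0. Assume that for each k the lower tail dependence function Λ_k(x,y) := lim_{ε→0⁺} C_k(εx, εy)/ε exists for all x, y > 0. Then the lower tail dependence coefficient of C̃ exists and factorizes: lim_{u→0⁺} C̃(u,u)/u = ∏_{k=1}^K λ_L(C_k), where λ_L(C_k) := lim_{u→0⁺} C_k(u,u)/u. -/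
open Set Filter

/-- A monotone function, positive near `0` on the right, whose ratio at `ε / 2` and `ε` tends to
a number other than `1` tends to `0` on the right of `0`. -/
theorem tendsto_zero_of_monotoneOn_of_ratio {g : ℝ → ℝ} {c : ℝ} (hc : c ≠ 1)
    (hmono : MonotoneOn g (Set.Icc 0 1)) (hpos : ∀ t ∈ Set.Ioc (0:ℝ) 1, 0 < g t)
    (hratio : Filter.Tendsto (fun ε => g (ε * (1 / 2)) / g ε) (nhdsWithin 0 (Set.Ioi 0))
      (nhds c)) :
    Filter.Tendsto g (nhdsWithin 0 (Set.Ioi 0)) (nhds 0) := by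
  have hlim := MonotoneOn.tendsto_nhdsWithin_Ioo_right (Set.nonempty_Ioo.2 one_pos)
    (hmono.mono Set.Ioo_subset_Icc_self)
    ⟨0, by rintro _ ⟨t, ht, rfl⟩; exact (hpos t ⟨ht.1, ht.2.le⟩).le⟩
  generalize sInf (g '' Set.Ioo 0 1) = a at hlim
  by_cases ha : a = 0
  · rwa [ha] at hlim
  have hhalf : Filter.Tendsto (fun ε : ℝ => ε * (1 / 2)) (nhdsWithin 0 (Set.Ioi 0))
      (nhdsWithin 0 (Set.Ioi 0)) := by
    refine tendsto_nhdsWithin_iff.2 ⟨?_, ?_⟩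
    · have h : Filter.Tendsto (fun ε : ℝ => ε * (1 / 2)) (nhds 0) (nhds (0 * (1 / 2))) :=
        Filter.tendsto_id.mul_const _
      rw [zero_mul] at h
      exact h.mono_left nhdsWithin_le_nhds
    · filter_upwards [self_mem_nhdsWithin] with ε hε
      exact mul_pos (Set.mem_Ioi.1 hε) one_half_pos
  have hone := (hlim.comp hhalf).div hlim ha
  rw [div_self ha] at hone
  exact absurd (tendsto_nhds_unique hratio hone) hc

/-- **Lower tail dependence coefficient of a Liebscher copula, symmetric case.**
Under the regular-variation assumptions on the common functions `g^{(k)}` and existence of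
the lower tail dependence functions of the `C_k`, the lower tail dependence coefficient
of `C̃` exists and factorizes: `λ_L(C̃) = ∏_k λ_L(C_k)`, where
`λ_L(C_k) = lim_{u→0⁺} C_k(u,u)/u`. -/
theorem liebscher_lower_tail_coefficient (K : ℕ) (hK : 1 ≤ K) (L : LiebscherSetup K)
    (g : Fin K → ℝ → ℝ) (hg₁ : ∀ k, L.g₁ k = g k) (hg₂ : ∀ k, L.g₂ k = g k)
    (γ : Fin K → ℝ) (hγ : ∀ k, 0 < γ k)
    (hgpos : ∀ k, ∀ t ∈ Set.Ioc (0:ℝ) 1, 0 < g k t)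
    (hRV : ∀ k, ∀ t > (0:ℝ),
      Filter.Tendsto (fun ε => g k (ε * t) / g k ε) (nhdsWithin 0 (Set.Ioi 0))
        (nhds (t ^ γ k)))
    (Λ : Fin K → ℝ → ℝ → ℝ)
    (hΛ : ∀ k, ∀ x > (0:ℝ), ∀ y > (0:ℝ),
      Filter.Tendsto (fun ε => L.C k (ε * x) (ε * y) / ε) (nhdsWithin 0 (Set.Ioi 0))
        (nhds (Λ k x y)))
    (lamL : Fin K → ℝ)
    (hlamL : ∀ k, Filter.Tendsto (fun u => L.C k u u / u) (nhdsWithin 0 (Set.Ioi 0))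
      (nhds (lamL k))) :
    Filter.Tendsto (fun u => L.Ct u u / u) (nhdsWithin 0 (Set.Ioi 0))
      (nhds (∏ k, lamL k)) := by
  have hunit : Set.Ioc (0:ℝ) 1 ∈ nhdsWithin 0 (Set.Ioi 0) := Ioc_mem_nhdsGT one_pos
  have hzero : ∀ k, Filter.Tendsto (g k) (nhdsWithin 0 (Set.Ioi 0))
      (nhdsWithin 0 (Set.Ioi 0)) := by
    intro k
    refine tendsto_nhdsWithin_iff.2 ⟨?_, ?_⟩
    · refine tendsto_zero_of_monotoneOn_of_ratio (c := (1 / 2 : ℝ) ^ γ k) ?_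
        (hg₁ k ▸ L.mono₁ k) (hgpos k) (hRV k _ (by norm_num))
      exact (Real.rpow_lt_one (by norm_num) (by norm_num) (hγ k)).ne
    · filter_upwards [hunit] with u hu
      exact hgpos k u hu
  have hprod := tendsto_finsetProd Finset.univ fun k _ => (hlamL k).comp (hzero k)
  refine hprod.congr' ?_
  filter_upwards [hunit] with u hu
  have hid := L.prodId₁ u ⟨hu.1.le, hu.2⟩
  simp only [hg₁] at hid
  simp only [LiebscherSetup.Ct, hg₁, hg₂, Function.comp_apply, Finset.prod_div_distrib, hid]
end

section
/- Consider the Liebscher copula C̃ built from bivariate copulas C₁,…,C_K. If every C_k is positively quadrant dependent, i.e. C_k(u,v) ≥ uv for all u,v ∈ [0,1], then C̃ is positively quadrant dependent: C̃(u,v) ≥ uv for all u,v ∈ [0,1]. Similarly, if every C_k is negatively quadrant dependent, i.e. C_k(u,v) ≤ uv for all u,v ∈ [0,1], then C̃(u,v) ≤ uv for all u,v ∈ [0,1]. -/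
open Set Filter

/-- **Quadrant dependence is preserved by Liebscher's construction.**
If every `C_k` is positively quadrant dependent (`C_k(u,v) ≥ uv`), then so is `C̃`;
if every `C_k` is negatively quadrant dependent (`C_k(u,v) ≤ uv`), then so is `C̃`. -/
theorem liebscher_quadrant_dependence (K : ℕ) (hK : 1 ≤ K) (L : LiebscherSetup K) :
    ((∀ k, ∀ u ∈ Set.Icc (0:ℝ) 1, ∀ v ∈ Set.Icc (0:ℝ) 1, u * v ≤ L.C k u v) →
      ∀ u ∈ Set.Icc (0:ℝ) 1, ∀ v ∈ Set.Icc (0:ℝ) 1, u * v ≤ L.Ct u v) ∧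
    ((∀ k, ∀ u ∈ Set.Icc (0:ℝ) 1, ∀ v ∈ Set.Icc (0:ℝ) 1, L.C k u v ≤ u * v) →
      ∀ u ∈ Set.Icc (0:ℝ) 1, ∀ v ∈ Set.Icc (0:ℝ) 1, L.Ct u v ≤ u * v) := by
  have prod_eq : ∀ u ∈ Set.Icc (0:ℝ) 1, ∀ v ∈ Set.Icc (0:ℝ) 1,
      ∏ k, L.g₁ k u * L.g₂ k v = u * v := fun u hu v hv => by
    rw [Finset.prod_mul_distrib, L.prodId₁ u hu, L.prodId₂ v hv]
  refine ⟨fun h u hu v hv => ?_, fun h u hu v hv => ?_⟩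
  · rw [← prod_eq u hu v hv]
    exact Finset.prod_le_prod
      (fun k _ => mul_nonneg (L.maps₁ k hu).1 (L.maps₂ k hv).1)
      (fun k _ => h k _ (L.maps₁ k hu) _ (L.maps₂ k hv))
  · rw [← prod_eq u hu v hv]
    exact Finset.prod_le_prod
      (fun k _ => ((L.copula k).1 _ (L.maps₁ k hu) _ (L.maps₂ k hv)).1)
      (fun k _ => h k _ (L.maps₁ k hu) _ (L.maps₂ k hv))
end

section
/- Consider the Liebscher copula C̃ built from bivariate copulas C₁,…,C_K. If every C_k is left-tail decreasing (LTD), i.e. u ↦ C_k(u,v)/u is nonincreasing on (0,1] for each fixed v ∈ [0,1] and v ↦ C_k(u,v)/v is nonincreasing on (0,1] for each fixed u ∈ [0,1], then C̃ is also LTD: u ↦ C̃(u,v)/u and v ↦ C̃(u,v)/v are nonincreasing on (0,1] for each fixed value of the other variable. The analogous statement holds with 'nonincreasing' replaced by 'nondecreasing' (the left-tail increasing property). -/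
open Set Filter

/-- If `∏ k, g k u = u` on `[0,1]` with every `g k` valued in `[0,1]`, then every `g k` maps
`(0,1]` into itself. -/
theorem mapsTo_Ioc_of_prod_eq_self {ι : Type*} [Fintype ι] {g : ι → ℝ → ℝ}
    (hmaps : ∀ k, MapsTo (g k) (Icc 0 1) (Icc 0 1))
    (hprod : ∀ u ∈ Icc (0:ℝ) 1, ∏ k, g k u = u) (k : ι) :
    MapsTo (g k) (Ioc 0 1) (Ioc 0 1) := by
  intro u hu
  have hu' := Ioc_subset_Icc_self hu
  have hne : g k u ≠ 0 := fun h =>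
    hu.1.ne' ((hprod u hu').symm.trans (Finset.prod_eq_zero (Finset.mem_univ k) h))
  exact ⟨lt_of_le_of_ne (hmaps k hu').1 hne.symm, (hmaps k hu').2⟩

theorem prod_comp_div_eq_prod {ι : Type*} [Fintype ι] {g F : ι → ℝ → ℝ}
    (hprod : ∀ u ∈ Icc (0:ℝ) 1, ∏ k, g k u = u) {u : ℝ} (hu : u ∈ Icc (0:ℝ) 1) :
    (∏ k, F k (g k u)) / u = ∏ k, F k (g k u) / g k u := by
  rw [Finset.prod_div_distrib, hprod u hu]

theorem antitoneOn_prod_comp_div {ι : Type*} [Fintype ι] {g F : ι → ℝ → ℝ}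
    (hmono : ∀ k, MonotoneOn (g k) (Icc 0 1))
    (hmaps : ∀ k, MapsTo (g k) (Icc 0 1) (Icc 0 1))
    (hprod : ∀ u ∈ Icc (0:ℝ) 1, ∏ k, g k u = u)
    (hF : ∀ k, ∀ u ∈ Icc (0:ℝ) 1, 0 ≤ F k u)
    (h : ∀ k, AntitoneOn (fun u => F k u / u) (Ioc 0 1)) :
    AntitoneOn (fun u => (∏ k, F k (g k u)) / u) (Ioc 0 1) := by
  intro a ha b hb hab
  have ha' := Ioc_subset_Icc_self ha
  have hb' := Ioc_subset_Icc_self hb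
  have hg := mapsTo_Ioc_of_prod_eq_self hmaps hprod
  simp only [prod_comp_div_eq_prod hprod ha', prod_comp_div_eq_prod hprod hb']
  exact Finset.prod_le_prod
    (fun k _ => div_nonneg (hF k _ (hmaps k hb')) (hmaps k hb').1)
    (fun k _ => h k (hg k ha) (hg k hb) (hmono k ha' hb' hab))

theorem monotoneOn_prod_comp_div {ι : Type*} [Fintype ι] {g F : ι → ℝ → ℝ}
    (hmono : ∀ k, MonotoneOn (g k) (Icc 0 1))
    (hmaps : ∀ k, MapsTo (g k) (Icc 0 1) (Icc 0 1))
    (hprod : ∀ u ∈ Icc (0:ℝ) 1, ∏ k, g k u = u)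
    (hF : ∀ k, ∀ u ∈ Icc (0:ℝ) 1, 0 ≤ F k u)
    (h : ∀ k, MonotoneOn (fun u => F k u / u) (Ioc 0 1)) :
    MonotoneOn (fun u => (∏ k, F k (g k u)) / u) (Ioc 0 1) := by
  intro a ha b hb hab
  have ha' := Ioc_subset_Icc_self ha
  have hb' := Ioc_subset_Icc_self hb
  have hg := mapsTo_Ioc_of_prod_eq_self hmaps hprod
  simp only [prod_comp_div_eq_prod hprod ha', prod_comp_div_eq_prod hprod hb']
  exact Finset.prod_le_prod
    (fun k _ => div_nonneg (hF k _ (hmaps k ha')) (hmaps k ha').1)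
    (fun k _ => h k (hg k ha) (hg k hb) (hmono k ha' hb' hab))

/-- **The LTD and LTI properties are preserved by Liebscher's construction.**
If for every `k` the maps `u ↦ C_k(u,v)/u` and `v ↦ C_k(u,v)/v` are nonincreasing on
`(0,1]` (left-tail decreasing), the same holds for `C̃`; the analogous statement holds
with nonincreasing replaced by nondecreasing (left-tail increasing). -/
theorem liebscher_LTD_LTI (K : ℕ) (hK : 1 ≤ K) (L : LiebscherSetup K) :
    ((∀ k, (∀ v ∈ Set.Icc (0:ℝ) 1, AntitoneOn (fun u => L.C k u v / u) (Set.Ioc 0 1)) ∧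
        (∀ u ∈ Set.Icc (0:ℝ) 1, AntitoneOn (fun v => L.C k u v / v) (Set.Ioc 0 1))) →
      (∀ v ∈ Set.Icc (0:ℝ) 1, AntitoneOn (fun u => L.Ct u v / u) (Set.Ioc 0 1)) ∧
      (∀ u ∈ Set.Icc (0:ℝ) 1, AntitoneOn (fun v => L.Ct u v / v) (Set.Ioc 0 1))) ∧
    ((∀ k, (∀ v ∈ Set.Icc (0:ℝ) 1, MonotoneOn (fun u => L.C k u v / u) (Set.Ioc 0 1)) ∧
        (∀ u ∈ Set.Icc (0:ℝ) 1, MonotoneOn (fun v => L.C k u v / v) (Set.Ioc 0 1))) →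
      (∀ v ∈ Set.Icc (0:ℝ) 1, MonotoneOn (fun u => L.Ct u v / u) (Set.Ioc 0 1)) ∧
      (∀ u ∈ Set.Icc (0:ℝ) 1, MonotoneOn (fun v => L.Ct u v / v) (Set.Ioc 0 1))) := by
  refine ⟨fun h => ⟨fun v hv => ?_, fun u hu => ?_⟩, fun h => ⟨fun v hv => ?_, fun u hu => ?_⟩⟩
  · exact antitoneOn_prod_comp_div (F := fun k x => L.C k x (L.g₂ k v)) L.mono₁ L.maps₁ L.prodId₁
      (fun k x hx => ((L.copula k).1 x hx _ (L.maps₂ k hv)).1)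
      (fun k => (h k).1 _ (L.maps₂ k hv))
  · exact antitoneOn_prod_comp_div (F := fun k x => L.C k (L.g₁ k u) x) L.mono₂ L.maps₂ L.prodId₂
      (fun k x hx => ((L.copula k).1 _ (L.maps₁ k hu) x hx).1)
      (fun k => (h k).2 _ (L.maps₁ k hu))
  · exact monotoneOn_prod_comp_div (F := fun k x => L.C k x (L.g₂ k v)) L.mono₁ L.maps₁ L.prodId₁
      (fun k x hx => ((L.copula k).1 x hx _ (L.maps₂ k hv)).1)
      (fun k => (h k).1 _ (L.maps₂ k hv))
  · exact monotoneOn_prod_comp_div (F := fun k x => L.C k (L.g₁ k u) x) L.mono₂ L.maps₂ L.prodId₂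
      (fun k x hx => ((L.copula k).1 _ (L.maps₁ k hu) x hx).1)
      (fun k => (h k).2 _ (L.maps₁ k hu))
end

section
/- Consider the Liebscher copula C̃ built from bivariate copulas C₁,…,C_K. If every C_k is totally positive of order 2 (TP₂), i.e. C_k(u₁,v₁)·C_k(u₂,v₂) ≥ C_k(u₁,v₂)·C_k(u₂,v₁) for all u₁ ≤ u₂ and v₁ ≤ v₂ in [0,1], then C̃ is also TP₂: C̃(u₁,v₁)·C̃(u₂,v₂) ≥ C̃(u₁,v₂)·C̃(u₂,v₁) whenever u₁ ≤ u₂ and v₁ ≤ v₂. -/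
open Set Filter

/-- **The TP₂ property is preserved by Liebscher's construction.**
If every `C_k` is totally positive of order 2 on `[0,1]²`, then so is the Liebscher
copula `C̃`. -/
theorem liebscher_TP2 (K : ℕ) (hK : 1 ≤ K) (L : LiebscherSetup K)
    (hTP2 : ∀ k, ∀ u₁ ∈ Set.Icc (0:ℝ) 1, ∀ u₂ ∈ Set.Icc (0:ℝ) 1,
      ∀ v₁ ∈ Set.Icc (0:ℝ) 1, ∀ v₂ ∈ Set.Icc (0:ℝ) 1, u₁ ≤ u₂ → v₁ ≤ v₂ →
        L.C k u₁ v₂ * L.C k u₂ v₁ ≤ L.C k u₁ v₁ * L.C k u₂ v₂) :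
    ∀ u₁ ∈ Set.Icc (0:ℝ) 1, ∀ u₂ ∈ Set.Icc (0:ℝ) 1,
      ∀ v₁ ∈ Set.Icc (0:ℝ) 1, ∀ v₂ ∈ Set.Icc (0:ℝ) 1, u₁ ≤ u₂ → v₁ ≤ v₂ →
        L.Ct u₁ v₂ * L.Ct u₂ v₁ ≤ L.Ct u₁ v₁ * L.Ct u₂ v₂ := by
  intro u₁ hu₁ u₂ hu₂ v₁ hv₁ v₂ hv₂ hu hv
  have nonneg : ∀ k, ∀ u ∈ Set.Icc (0:ℝ) 1, ∀ v ∈ Set.Icc (0:ℝ) 1,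
      0 ≤ L.C k (L.g₁ k u) (L.g₂ k v) := fun k u hu v hv =>
    ((L.copula k).1 _ (L.maps₁ k hu) _ (L.maps₂ k hv)).1
  simp only [LiebscherSetup.Ct, ← Finset.prod_mul_distrib]
  exact Finset.prod_le_prod
    (fun k _ => mul_nonneg (nonneg k _ hu₁ _ hv₂) (nonneg k _ hu₂ _ hv₁))
    (fun k _ => hTP2 k _ (L.maps₁ k hu₁) _ (L.maps₁ k hu₂) _ (L.maps₂ k hv₁) _ (L.maps₂ k hv₂)
      (L.mono₁ k hu₁ hu₂ hu) (L.mono₂ k hv₁ hv₂ hv))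
end

section
/- Let d, m, K ≥ 1, let λ₁,…,λ_m be real numbers, and for each i ∈ {1,…,m} let φ_i : [0,1]^d → [0,1] satisfy φ_i(u) > 0 for all u ∈ (0,1]^d and the homogeneity property: for all t > 0 and all x ∈ ℝ^d with x_j ≤ 0 for every j, ln φ_i(e^{t x₁},…,e^{t x_d}) = t^{λ_i} · ln φ_i(e^{x₁},…,e^{x_d}). Let θ_{ik} ∈ ℝ for i ∈ {1,…,m}, k ∈ {1,…,K}, and let p^{(1)},…,p^{(K)} ∈ (0,1) with ∑_{k=1}^K p^{(k)} = 1. Then for all u = (u₁,…,u_d) ∈ (0,1]^d, ∏_{k=1}^K ∏_{i=1}^m φ_i(u₁^{p^{(k)}},…,u_d^{p^{(k)}})^{θ_{ik}} = ∏_{i=1}^m φ_i(u₁,…,u_d)^{θ̃_i}, where θ̃_i = ∑_{k=1}^K θ_{ik} (p^{(k)})^{λ_i}. In particular, the Liebscher combination with power functions g_j^{(k)}(t) = t^{p^{(k)}} of copulas of the parametric form C(·|θ_k) = ∏_i φ_i^{θ_{ik}} belongs to the same parametric family, with parameter θ̃ = (θ̃₁,…,θ̃_m). -/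
open Set

/-- **Stability of homogeneous parametric families under Liebscher's construction with
power functions.** Let `φ_i : [0,1]^d → [0,1]` be positive on `(0,1]^d` with
`ln ∘ φ_i ∘ exp` homogeneous of degree `λ_i`, let `θ_{ik} ∈ ℝ`, and let
`p^{(1)},…,p^{(K)} ∈ (0,1)` sum to 1. Then the Liebscher combination with power functions
`g_j^{(k)}(t) = t^{p^{(k)}}` of the functions `C(·|θ_k) = ∏_i φ_i^{θ_{ik}}` equals
`C(·|θ̃)` with `θ̃_i = ∑_k θ_{ik} (p^{(k)})^{λ_i}`. -/
theorem liebscher_stability_homogeneous_family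
    (d m K : ℕ) (hd : 1 ≤ d) (hm : 1 ≤ m) (hK : 1 ≤ K)
    (lam : Fin m → ℝ)
    (φ : Fin m → (Fin d → ℝ) → ℝ)
    (hφmaps : ∀ i, ∀ u : Fin d → ℝ, (∀ j, u j ∈ Set.Icc (0:ℝ) 1) →
      φ i u ∈ Set.Icc (0:ℝ) 1)
    (hφpos : ∀ i, ∀ u : Fin d → ℝ, (∀ j, u j ∈ Set.Ioc (0:ℝ) 1) → 0 < φ i u)
    (hhom : ∀ i, ∀ t > (0:ℝ), ∀ x : Fin d → ℝ, (∀ j, x j ≤ 0) →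
      Real.log (φ i (fun j => Real.exp (t * x j))) =
        t ^ lam i * Real.log (φ i (fun j => Real.exp (x j))))
    (θ : Fin m → Fin K → ℝ)
    (p : Fin K → ℝ) (hp : ∀ k, p k ∈ Set.Ioo (0:ℝ) 1) (hsum : ∑ k, p k = 1) :
    ∀ u : Fin d → ℝ, (∀ j, u j ∈ Set.Ioc (0:ℝ) 1) →
      ∏ k, ∏ i, (φ i (fun j => u j ^ p k)) ^ θ i k =
        ∏ i, (φ i u) ^ (∑ k, θ i k * p k ^ lam i) := by
  intro u hu
  have hupow : ∀ k j, u j ^ p k ∈ Set.Ioc (0:ℝ) 1 := fun k j =>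
    ⟨Real.rpow_pos_of_pos (hu j).1 _,
      Real.rpow_le_one (hu j).1.le (hu j).2 (hp k).1.le⟩
  have key : ∀ i k, φ i (fun j => u j ^ p k) = φ i u ^ (p k ^ lam i) := by
    intro i k
    have h := hhom i (p k) (hp k).1 (fun j => Real.log (u j))
      (fun j => Real.log_nonpos (hu j).1.le (hu j).2)
    have hscaled : (fun j => Real.exp (p k * Real.log (u j))) = fun j => u j ^ p k := by
      funext j
      rw [Real.rpow_def_of_pos (hu j).1, mul_comm]
    have hone : (fun j => Real.exp (Real.log (u j))) = u :=
      funext fun j => Real.exp_log (hu j).1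
    rw [hscaled, hone] at h
    rw [← Real.exp_log (hφpos i _ (hupow k)), h, Real.rpow_def_of_pos (hφpos i u hu),
      mul_comm]
  rw [Finset.prod_comm]
  refine Finset.prod_congr rfl fun i _ => ?_
  rw [Real.rpow_sum_of_pos (hφpos i u hu)]
  refine Finset.prod_congr rfl fun k _ => ?_
  rw [key, ← Real.rpow_mul (hφpos i u hu).le, mul_comm]
end

section
/- Let d ≥ 1, K ≥ 1, let C₁,…,C_K : [0,1]^d → [0,1] be arbitrary functions, and for each k ∈ {2,…,K} and j ∈ {1,…,d} let f_j^{(k)} : [0,1] → [0,1] be increasing with f_j^{(k)}(0) = 0, f_j^{(k)}(1) = 1 and such that t ↦ t/f_j^{(k)}(t) is increasing on (0,1] with values in [0,1]; set f_j^{(1)} ≡ 1. Define recursively, for u ∈ (0,1]^d: C̃^{(1)}(u) = C₁(u), and C̃^{(k)}(u) = C_k(u₁/f_1^{(k)}(u₁),…,u_d/f_d^{(k)}(u_d)) · C̃^{(k−1)}(f_1^{(k)}(u₁),…,f_d^{(k)}(u_d)) for k ≥ 2. Define g_j^{(1,K)}(t) = t/f_j^{(K)}(t) and, for k ∈ {2,…,K},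 g_j^{(k,K)}(t) = (f_j^{(K−k+2)}∘⋯∘f_j^{(K)})(t) / (f_j^{(K−k+1)}∘⋯∘f_j^{(K)})(t). Then for all u ∈ (0,1]^d, C̃^{(K)}(u) = ∏_{k=1}^K C_k(g_1^{(K−k+1,K)}(u₁),…,g_d^{(K−k+1,K)}(u_d)), and moreover the functions g automatically satisfy Liebscher's constraint ∏_{k=1}^K g_j^{(k,K)}(t) = t for all t ∈ (0,1] and j ∈ {1,…,d}. -/
open Set

/-- The composition `f^{(i)} ∘ f^{(i+1)} ∘ ⋯ ∘ f^{(j)}`, with the convention that an empty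
composition (`i > j`) is the identity. -/
def compIcc (f : ℕ → ℝ → ℝ) (i j : ℕ) : ℝ → ℝ :=
  (List.range (j + 1 - i)).foldl (fun acc n => acc ∘ f (i + n)) id

theorem compIcc_of_lt (f : ℕ → ℝ → ℝ) {i j : ℕ} (h : j < i) : compIcc f i j = id := by
  simp [compIcc, Nat.sub_eq_zero_of_le (Nat.succ_le_of_lt h)]

theorem compIcc_succ_right (f : ℕ → ℝ → ℝ) {i j : ℕ} (h : i ≤ j + 1) :
    compIcc f i (j + 1) = compIcc f i j ∘ f (j + 1) := by
  unfold compIcc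
  rw [show j + 1 + 1 - i = (j + 1 - i) + 1 by lia, List.range_succ, List.foldl_append]
  simp only [List.foldl_cons, List.foldl_nil]
  rw [Nat.add_sub_cancel' h]

theorem prod_compIcc_succ {ι M : Type*} [CommMonoid M] (C : ℕ → (ι → ℝ) → M)
    (f : ℕ → ι → ℝ → ℝ) (n : ℕ) (u : ι → ℝ) :
    ∏ k ∈ Finset.Icc 1 (n + 1),
        C k (fun j => compIcc (fun i => f i j) (k + 1) (n + 1) (u j) /
          compIcc (fun i => f i j) k (n + 1) (u j)) =
      C (n + 1) (fun j => u j / f (n + 1) j (u j)) *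
        ∏ k ∈ Finset.Icc 1 n,
          C k (fun j => compIcc (fun i => f i j) (k + 1) n (f (n + 1) j (u j)) /
            compIcc (fun i => f i j) k n (f (n + 1) j (u j))) := by
  rw [Finset.prod_Icc_succ_top (by lia), mul_comm]
  congr 1
  · simp [compIcc_of_lt, compIcc_succ_right]
  · refine Finset.prod_congr rfl fun k hk => ?_
    have hkn := (Finset.mem_Icc.mp hk).2
    simp only [compIcc_succ_right _ (show k + 1 ≤ n + 1 by lia),
      compIcc_succ_right _ (show k ≤ n + 1 by lia), Function.comp_apply]

theorem eq_prod_compIcc_of_recursion {ι M : Type*} [CommMonoid M] {K : ℕ}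
    (C : ℕ → (ι → ℝ) → M) (f : ℕ → ι → ℝ → ℝ) (S : Set ℝ)
    (hf1 : ∀ j t, f 1 j t = 1)
    (hmaps : ∀ k, 2 ≤ k → k ≤ K → ∀ j, MapsTo (f k j) S S)
    (Ct : ℕ → (ι → ℝ) → M) (hbase : ∀ u, Ct 1 u = C 1 u)
    (hstep : ∀ k, 2 ≤ k → k ≤ K → ∀ u : ι → ℝ, (∀ j, u j ∈ S) →
      Ct k u = C k (fun j => u j / f k j (u j)) * Ct (k - 1) (fun j => f k j (u j)))
    (hK : 1 ≤ K) (u : ι → ℝ) (hu : ∀ j, u j ∈ S) :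
    Ct K u = ∏ k ∈ Finset.Icc 1 K,
      C k (fun j => compIcc (fun i => f i j) (k + 1) K (u j) /
        compIcc (fun i => f i j) k K (u j)) := by
  induction K, hK using Nat.le_induction generalizing u with
  | base => simpa [hf1, hbase] using (prod_compIcc_succ C f 0 u).symm
  | succ n hn ih =>
    rw [prod_compIcc_succ, hstep (n + 1) (by lia) le_rfl u hu, Nat.add_sub_cancel,
      ih (fun k h2 hk => hmaps k h2 (by lia)) (fun k h2 hk => hstep k h2 (by lia))
        (fun j => f (n + 1) j (u j)) fun j => hmaps (n + 1) (by lia) le_rfl j (hu j)]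

/-- **Iterative representation of Liebscher copulas.** The iteratively constructed
`C̃^{(k)}(u) = C_k(u₁/f₁^{(k)}(u₁),…) · C̃^{(k−1)}(f₁^{(k)}(u₁),…)` satisfies
`C̃^{(K)}(u) = ∏_{k=1}^K C_k(g₁^{(K−k+1,K)}(u₁),…,g_d^{(K−k+1,K)}(u_d))` where
`g_j^{(k,K)} = (f_j^{(K−k+2)}∘⋯∘f_j^{(K)}) / (f_j^{(K−k+1)}∘⋯∘f_j^{(K)})`
(so that `g_j^{(K−k+1,K)}(t) = compIcc (k+1) K t / compIcc k K t`), and these functions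
automatically satisfy Liebscher's constraint `∏_{k=1}^K g_j^{(k,K)}(t) = t` on `(0,1]`. -/
theorem liebscher_iterative_representation
    (d K : ℕ) (hd : 1 ≤ d) (hK : 1 ≤ K)
    (C : ℕ → (Fin d → ℝ) → ℝ)
    (f : ℕ → Fin d → ℝ → ℝ)
    (hf1 : ∀ j t, f 1 j t = 1)
    (hfmono : ∀ k, 2 ≤ k → k ≤ K → ∀ j, MonotoneOn (f k j) (Set.Icc 0 1))
    (hf0 : ∀ k, 2 ≤ k → k ≤ K → ∀ j, f k j 0 = 0)
    (hf1' : ∀ k, 2 ≤ k → k ≤ K → ∀ j, f k j 1 = 1)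
    (hfmaps : ∀ k, 2 ≤ k → k ≤ K → ∀ j, Set.MapsTo (f k j) (Set.Icc 0 1) (Set.Icc 0 1))
    (hquotmono : ∀ k, 2 ≤ k → k ≤ K → ∀ j,
      MonotoneOn (fun t => t / f k j t) (Set.Ioc 0 1))
    (hquotmaps : ∀ k, 2 ≤ k → k ≤ K → ∀ j, ∀ t ∈ Set.Ioc (0:ℝ) 1,
      t / f k j t ∈ Set.Icc (0:ℝ) 1)
    (hge : ∀ k, 2 ≤ k → k ≤ K → ∀ j, ∀ t ∈ Set.Ioc (0:ℝ) 1, t ≤ f k j t)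
    (Ct : ℕ → (Fin d → ℝ) → ℝ)
    (hbase : ∀ u : Fin d → ℝ, Ct 1 u = C 1 u)
    (hstep : ∀ k, 2 ≤ k → k ≤ K → ∀ u : Fin d → ℝ, (∀ j, u j ∈ Set.Ioc (0:ℝ) 1) →
      Ct k u = C k (fun j => u j / f k j (u j)) * Ct (k - 1) (fun j => f k j (u j))) :
    (∀ u : Fin d → ℝ, (∀ j, u j ∈ Set.Ioc (0:ℝ) 1) →
      Ct K u = ∏ k ∈ Finset.Icc 1 K,
        C k (fun j => compIcc (fun i => f i j) (k + 1) K (u j) /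
              compIcc (fun i => f i j) k K (u j))) ∧
    (∀ j : Fin d, ∀ t ∈ Set.Ioc (0:ℝ) 1,
      ∏ k ∈ Finset.Icc 1 K,
        (compIcc (fun i => f i j) (k + 1) K t /
          compIcc (fun i => f i j) k K t) = t) := by
  have hmaps : ∀ k, 2 ≤ k → k ≤ K → ∀ j, MapsTo (f k j) (Ioc 0 1) (Ioc 0 1) :=
    fun k h2 hk j t ht => ⟨ht.1.trans_le (hge k h2 hk j t ht),
      (hfmaps k h2 hk j (Ioc_subset_Icc_self ht)).2⟩
  refine ⟨eq_prod_compIcc_of_recursion C f _ hf1 hmaps Ct hbase hstep hK, fun j t ht => ?_⟩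
  refine (eq_prod_compIcc_of_recursion (fun _ v => v j) f _ hf1 hmaps (fun _ v => v j)
    (fun _ => rfl) (fun k h2 hk u hu => ?_) hK (fun _ => t) fun _ => ht).symm
  exact (div_mul_cancel₀ _ (hmaps k h2 hk j (hu j)).1.ne').symm
end

section
/- Let K ≥ 1 and p₁,…,p_K, q₁,…,q_K ∈ (0,1) with ∑_{k=1}^K p_k = ∑_{k=1}^K q_k = 1. Set r_k = p_k/q_k and assume r₁ ≤ r₂ ≤ ⋯ ≤ r_K; set also r₀ = 0 and r_{K+1} = +∞. Write p̄_k = p₁+⋯+p_k and q̄_k = q₁+⋯+q_k (with p̄₀ = q̄₀ = 0). Then for every k ∈ {0,1,…,K} and every (u,v) ∈ (0,1) × (0,1] such that u^{r_{k+1}} < v ≤ u^{r_k} (with the conventions u^{r₀} = 1 and u^{r_{K+1}} = 0), the comonotonic-based Liebscher copula satisfies ∏_{j=1}^K min(u^{p_j}, v^{q_j}) = u^{1−p̄_k} · v^{q̄_k}. -/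
open Set

/-- If consecutive terms of `f` are nondecreasing on `{1, …, K}`, then `f` is monotone there. -/
lemma le_of_consecutive_le {f : ℕ → ℝ} {K : ℕ}
    (hf : ∀ j, 1 ≤ j → j < K → f j ≤ f (j + 1)) {i j : ℕ} (hi : 1 ≤ i) (hij : i ≤ j)
    (hj : j ≤ K) : f i ≤ f j := by
  induction j, hij using Nat.le_induction with
  | base => exact le_rfl
  | succ n hn ih => exact (ih (by omega)).trans (hf n (by omega) (by omega))

lemma rpow_div_rpow_cancel {u : ℝ} (hu : 0 ≤ u) (a : ℝ) {b : ℝ} (hb : b ≠ 0) :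
    (u ^ (a / b)) ^ b = u ^ a := by
  rw [← Real.rpow_mul hu, div_mul_cancel₀ a hb]

/-- **Piecewise geometric form of the comonotonic-based Liebscher copula.**
With weights `p₁,…,p_K, q₁,…,q_K ∈ (0,1)` summing to 1, ratios `r_j = p_j/q_j`
nondecreasing, and `(u,v) ∈ (0,1) × (0,1]` lying in the moon-shaped region
`u^{r_{k+1}} < v ≤ u^{r_k}` (conventions `u^{r₀} = 1`, `u^{r_{K+1}} = 0`), one has
`∏_{j=1}^K min(u^{p_j}, v^{q_j}) = u^{1−p̄_k} v^{q̄_k}`. -/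
theorem comonotonic_liebscher_piecewise
    (K : ℕ) (hK : 1 ≤ K) (p q : ℕ → ℝ)
    (hp : ∀ j ∈ Finset.Icc 1 K, p j ∈ Set.Ioo (0:ℝ) 1)
    (hq : ∀ j ∈ Finset.Icc 1 K, q j ∈ Set.Ioo (0:ℝ) 1)
    (hps : ∑ j ∈ Finset.Icc 1 K, p j = 1)
    (hqs : ∑ j ∈ Finset.Icc 1 K, q j = 1)
    (hr : ∀ j, 1 ≤ j → j < K → p j / q j ≤ p (j + 1) / q (j + 1))
    (k : ℕ) (hk : k ≤ K)
    (u v : ℝ) (hu : u ∈ Set.Ioo (0:ℝ) 1) (hv : v ∈ Set.Ioc (0:ℝ) 1)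
    (hlow : k < K → u ^ (p (k + 1) / q (k + 1)) < v)
    (hupp : 1 ≤ k → v ≤ u ^ (p k / q k)) :
    ∏ j ∈ Finset.Icc 1 K, min (u ^ p j) (v ^ q j) =
      u ^ (1 - ∑ j ∈ Finset.Icc 1 k, p j) * v ^ (∑ j ∈ Finset.Icc 1 k, q j) := by
  obtain ⟨hu0, hu1⟩ := hu
  have hv0 : 0 < v := hv.1
  have hsub : Finset.Icc 1 k ⊆ Finset.Icc 1 K := Finset.Icc_subset_Icc_right hk
  have hexp : 1 - ∑ j ∈ Finset.Icc 1 k, p j = ∑ j ∈ Finset.Icc 1 K \ Finset.Icc 1 k, p j := by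
    rw [← hps, ← Finset.sum_sdiff hsub, add_sub_cancel_right]
  rw [hexp, Real.rpow_sum_of_pos hu0, Real.rpow_sum_of_pos hv0, ← Finset.prod_sdiff hsub]
  congr 1
  · refine Finset.prod_congr rfl fun j hj => min_eq_left ?_
    obtain ⟨hjK, hjk⟩ := Finset.mem_sdiff.1 hj
    have hqj := (hq j hjK).1
    rw [Finset.mem_Icc] at hjK hjk
    have hmono := le_of_consecutive_le (f := fun i => p i / q i) hr
      (show 1 ≤ k + 1 by omega) (show k + 1 ≤ j by omega) hjK.2
    have hle : u ^ (p j / q j) ≤ v :=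
      (Real.rpow_le_rpow_of_exponent_ge hu0 hu1.le hmono).trans (hlow (by omega)).le
    rw [← rpow_div_rpow_cancel hu0.le (p j) hqj.ne']
    exact Real.rpow_le_rpow (Real.rpow_nonneg hu0.le _) hle hqj.le
  · refine Finset.prod_congr rfl fun j hj => min_eq_right ?_
    have hqj := (hq j (hsub hj)).1
    rw [Finset.mem_Icc] at hj
    have hmono := le_of_consecutive_le (f := fun i => p i / q i) hr hj.1 hj.2 hk
    have hle : v ≤ u ^ (p j / q j) :=
      (hupp (by omega)).trans (Real.rpow_le_rpow_of_exponent_ge hu0 hu1.le hmono)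
    rw [← rpow_div_rpow_cancel hu0.le (p j) hqj.ne']
    exact Real.rpow_le_rpow hv0.le hle hqj.le
end

section
/- Let 0 < p ≤ q < 1 and define the region A₁ = {(x,y) ∈ (0,1)² : x^{(1−p)/(1−q)} < y ≤ x^{p/q}}. Then for all (u,v) ∈ [0,1]², the comonotonic-based Liebscher copula with K = 2, C̃(u,v) = min(u^p, v^q) · min(u^{1−p}, v^{1−q}), decomposes as C̃(u,v) = S(u,v) + ∫_0^u ∫_0^v 𝟙_{A₁}(x,y) · (1−p) q x^{−p} y^{q−1} dy dx, where the singular component is S(u,v) = p·min(u, v^{q/p}) + (1−q)·min(u^{(1−p)/(1−q)}, v). In particular, the total mass of the absolutely continuous part is 1 − S(1,1) = 1 − p − (1−q), i.e. the singular part has mass p + (1−q) = min(p,q) + min(1−p, 1−q). -/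
open Set MeasureTheory intervalIntegral

/-- For fixed `x`, the integral over `[0, v]` of the density restricted to the region
`x ^ a < y ≤ x ^ b`. -/
lemma integral_density_section {a b c q x v : ℝ} (hq : 0 < q) (hb : 0 < b) (hba : b ≤ a)
    (hx : x ∈ Ioo (0:ℝ) 1) (hv : 0 ≤ v) :
    (∫ y in (0:ℝ)..v,
      (if x ∈ Ioo (0:ℝ) 1 ∧ y ∈ Ioo (0:ℝ) 1 ∧ x ^ a < y ∧ y ≤ x ^ b
        then c * y ^ (q - 1) else 0)) =
      c / q * (min (v ^ q) (x ^ (b * q)) - min (v ^ q) (x ^ (a * q))) := by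
  have hxa : 0 < x ^ a := Real.rpow_pos_of_pos hx.1 a
  have hxb : x ^ b < 1 := Real.rpow_lt_one hx.1.le hx.2 hb
  have hab : x ^ a ≤ x ^ b := Real.rpow_le_rpow_of_exponent_ge hx.1 hx.2.le hba
  have hmin : min v (x ^ a) ≤ min v (x ^ b) := min_le_min_left v hab
  have hpow : ∀ d : ℝ, (min v (x ^ d)) ^ q = min (v ^ q) (x ^ (d * q)) := fun d ↦ by
    rw [Real.rpow_mul hx.1.le]
    have hd := Real.rpow_nonneg hx.1.le d
    rcases le_total v (x ^ d) with h | h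
    · rw [min_eq_left h, min_eq_left (Real.rpow_le_rpow hv h hq.le)]
    · rw [min_eq_right h, min_eq_right (Real.rpow_le_rpow hd h hq.le)]
  have hind : (fun y : ℝ ↦ if x ∈ Ioo (0:ℝ) 1 ∧ y ∈ Ioo (0:ℝ) 1 ∧ x ^ a < y ∧ y ≤ x ^ b
        then c * y ^ (q - 1) else 0) =
      (Ioc (x ^ a) (x ^ b)).indicator fun y ↦ c * y ^ (q - 1) := by
    funext y
    rw [indicator_apply]
    refine if_congr ⟨fun h ↦ h.2.2, fun h ↦ ⟨hx, ⟨hxa.trans h.1, h.2.trans_lt hxb⟩, h⟩⟩ rfl rfl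
  have hset : Ioc (0:ℝ) v ∩ Ioc (x ^ a) (x ^ b) = Ioc (min v (x ^ a)) (min v (x ^ b)) := by
    ext y
    simp only [mem_inter_iff, mem_Ioc, min_lt_iff, le_min_iff]
    constructor
    · rintro ⟨⟨-, h₁⟩, h₂, h₃⟩
      exact ⟨Or.inr h₂, h₁, h₃⟩
    · rintro ⟨h₁, h₂, h₃⟩
      have h : x ^ a < y := h₁.resolve_left h₂.not_gt
      exact ⟨⟨hxa.trans h, h₂⟩, h, h₃⟩
  rw [hind, integral_of_le hv, setIntegral_indicator measurableSet_Ioc, hset,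
    ← integral_of_le hmin, intervalIntegral.integral_const_mul,
    integral_rpow (Or.inl (by linarith)), sub_add_cancel, hpow, hpow]
  ring

/-- Away from the two support curves of the singular part, the derivative in `u` of the copula
minus its singular part is the integral of the density over the section at `u`. -/
lemma hasDerivAt_comonotonic_liebscher_sub_singular {p q v x : ℝ} (hp : 0 < p) (hpq : p ≤ q)
    (hq : q < 1) (hv : v ∈ Icc (0:ℝ) 1) (hx : 0 < x) (hβ : x ≠ v ^ (q / p))
    (hα : x ≠ v ^ ((1 - q) / (1 - p))) :
    HasDerivAt (fun u : ℝ ↦ min (u ^ p) (v ^ q) * min (u ^ (1 - p)) (v ^ (1 - q)) -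
        (p * min u (v ^ (q / p)) + (1 - q) * min (u ^ ((1 - p) / (1 - q))) v))
      ((1 - p) * x ^ (-p) * (min (v ^ q) (x ^ p) -
        min (v ^ q) (x ^ ((1 - p) / (1 - q) * q)))) x := by
  have hp1 : 0 < 1 - p := by linarith
  have hq1 : 0 < 1 - q := by linarith
  have hq0 : 0 < q := hp.trans_le hpq
  have ha : 0 < (1 - p) / (1 - q) := div_pos hp1 hq1
  set a := (1 - p) / (1 - q) with hadef
  set β := v ^ (q / p) with hβdef
  set α := v ^ ((1 - q) / (1 - p)) with hαdef
  have hβ0 : 0 ≤ β := Real.rpow_nonneg hv.1 _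
  have hα0 : 0 ≤ α := Real.rpow_nonneg hv.1 _
  have hβα : β ≤ α := by
    refine Real.rpow_le_rpow_of_exponent_ge' hv.1 hv.2 (div_pos hq1 hp1).le ?_
    exact ((div_le_one hp1).2 (by linarith)).trans ((one_le_div hp).2 hpq)
  have eβ : β ^ p = v ^ q := by
    rw [hβdef, ← Real.rpow_mul hv.1, div_mul_cancel₀ _ hp.ne']
  have eα : α ^ (1 - p) = v ^ (1 - q) := by
    rw [hαdef, ← Real.rpow_mul hv.1, div_mul_cancel₀ _ hp1.ne']
  have eαa : α ^ a = v := by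
    rw [hαdef, ← Real.rpow_mul hv.1, hadef, div_mul_div_cancel₀ hp1.ne', div_self hq1.ne',
      Real.rpow_one]
  have eαq : α ^ (a * q) = v ^ q := by rw [Real.rpow_mul hα0, eαa]
  have mono : ∀ {s t r : ℝ}, 0 ≤ s → s ≤ t → 0 < r → s ^ r ≤ t ^ r :=
    fun hs hst hr ↦ Real.rpow_le_rpow hs hst hr.le
  have haq : 0 < a * q := mul_pos ha hq0
  have hsplit : ∀ {u : ℝ}, 0 < u → u ^ p * u ^ (1 - p) = u := fun hu ↦ by
    rw [← Real.rpow_add hu, add_sub_cancel, Real.rpow_one]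
  have hvsplit : v ^ q * v ^ (1 - q) = v := by
    rw [← Real.rpow_add_of_nonneg hv.1 hq0.le hq1.le, add_sub_cancel, Real.rpow_one]
  have hxsplit : x ^ (-p) * x ^ p = 1 := by
    rw [← Real.rpow_add hx, neg_add_cancel, Real.rpow_zero]
  have hxa : x ^ (-p) * x ^ (a * q) = x ^ (a - 1) := by
    rw [← Real.rpow_add hx, hadef]
    congr 1
    field_simp
    ring
  have hcoef : (1 - q) * a = 1 - p := by rw [hadef, mul_div_cancel₀ _ hq1.ne']
  have hda : HasDerivAt (fun u : ℝ ↦ (1 - q) * u ^ a) ((1 - p) * x ^ (a - 1)) x := by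
    rw [← hcoef, mul_assoc]
    exact (Real.hasDerivAt_rpow_const (Or.inl hx.ne')).const_mul (1 - q)
  rcases lt_or_gt_of_ne hβ with h | h
  · have hxα := h.trans_le hβα
    rw [min_eq_right (eβ ▸ mono hx.le h.le hp), min_eq_right (eαq ▸ mono hx.le hxα.le haq)]
    have hd : HasDerivAt (fun u : ℝ ↦ u - (p * u + (1 - q) * u ^ a))
        (1 - (p * 1 + (1 - p) * x ^ (a - 1))) x :=
      (hasDerivAt_id' x).sub (((hasDerivAt_id' x).const_mul p).add hda)
    have hval : (1 - p) * x ^ (-p) * (x ^ p - x ^ (a * q)) =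
        1 - (p * 1 + (1 - p) * x ^ (a - 1)) := by
      linear_combination (1 - p) * hxsplit - (1 - p) * hxa
    rw [hval]
    refine hd.congr_of_eventuallyEq ?_
    filter_upwards [Ioo_mem_nhds hx h] with u hu
    have huα := hu.2.le.trans hβα
    rw [min_eq_left (eβ ▸ mono hu.1.le hu.2.le hp), min_eq_left (eα ▸ mono hu.1.le huα hp1),
      min_eq_left hu.2.le, min_eq_left (eαa ▸ mono hu.1.le huα ha), hsplit hu.1]
  · rw [min_eq_left (eβ ▸ mono hβ0 h.le hp)]
    rcases lt_or_gt_of_ne hα with h' | h'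
    · rw [min_eq_right (eαq ▸ mono hx.le h'.le haq)]
      have hd : HasDerivAt (fun u : ℝ ↦ v ^ q * u ^ (1 - p) - (p * β + (1 - q) * u ^ a))
          (v ^ q * ((1 - p) * x ^ (1 - p - 1)) - (1 - p) * x ^ (a - 1)) x :=
        ((Real.hasDerivAt_rpow_const (Or.inl hx.ne')).const_mul _).sub (hda.const_add _)
      have hval : (1 - p) * x ^ (-p) * (v ^ q - x ^ (a * q)) =
          v ^ q * ((1 - p) * x ^ (1 - p - 1)) - (1 - p) * x ^ (a - 1) := by
        rw [show 1 - p - 1 = -p by ring]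
        linear_combination -(1 - p) * hxa
      rw [hval]
      refine hd.congr_of_eventuallyEq ?_
      filter_upwards [Ioo_mem_nhds h h'] with u hu
      have hu0 := hβ0.trans hu.1.le
      rw [min_eq_right (eβ ▸ mono hβ0 hu.1.le hp), min_eq_left (eα ▸ mono hu0 hu.2.le hp1),
        min_eq_right hu.1.le, min_eq_left (eαa ▸ mono hu0 hu.2.le ha)]
    · rw [min_eq_left (eαq ▸ mono hα0 h'.le haq), sub_self, mul_zero]
      refine (hasDerivAt_const x (v - (p * β + (1 - q) * v))).congr_of_eventuallyEq ?_
      filter_upwards [Ioi_mem_nhds h'] with u hu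
      have huα : α ≤ u := le_of_lt hu
      have huβ := hβα.trans huα
      rw [min_eq_right (eβ ▸ mono hβ0 huβ hp), min_eq_right (eα ▸ mono hα0 huα hp1),
        min_eq_right huβ, min_eq_right (eαa ▸ mono hα0 huα ha), hvsplit]

/-- **Singular/absolutely continuous decomposition of the comonotonic-based Liebscher
copula with `K = 2`.** For `0 < p ≤ q < 1`, the copula
`C̃(u,v) = min(u^p, v^q) · min(u^{1−p}, v^{1−q})` decomposes as the sum of the singular
component `S(u,v) = p·min(u, v^{q/p}) + (1−q)·min(u^{(1−p)/(1−q)}, v)` and the integral of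
the density `(1−p) q x^{−p} y^{q−1}` over the region
`A₁ = {(x,y) ∈ (0,1)² : x^{(1−p)/(1−q)} < y ≤ x^{p/q}}` intersected with `[0,u] × [0,v]`;
in particular the absolutely continuous part has total mass `1 − S(1,1) = 1 − p − (1−q)`,
i.e. the singular part has mass `p + (1−q) = min(p,q) + min(1−p, 1−q)`. -/
theorem comonotonic_liebscher_K2_decomposition
    (p q : ℝ) (hp : 0 < p) (hpq : p ≤ q) (hq : q < 1) :
    (∀ u ∈ Set.Icc (0:ℝ) 1, ∀ v ∈ Set.Icc (0:ℝ) 1,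
      min (u ^ p) (v ^ q) * min (u ^ (1 - p)) (v ^ (1 - q)) =
        (p * min u (v ^ (q / p)) + (1 - q) * min (u ^ ((1 - p) / (1 - q))) v) +
        ∫ x in (0:ℝ)..u, ∫ y in (0:ℝ)..v,
          (if x ∈ Set.Ioo (0:ℝ) 1 ∧ y ∈ Set.Ioo (0:ℝ) 1 ∧
              x ^ ((1 - p) / (1 - q)) < y ∧ y ≤ x ^ (p / q)
            then (1 - p) * q * x ^ (-p) * y ^ (q - 1) else 0)) ∧
    (1 - (p * min (1:ℝ) ((1:ℝ) ^ (q / p)) + (1 - q) * min ((1:ℝ) ^ ((1 - p) / (1 - q))) 1)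
        = 1 - p - (1 - q)) ∧
    (p + (1 - q) = min p q + min (1 - p) (1 - q)) := by
  have hp1 : 0 < 1 - p := by linarith
  have hq1 : 0 < 1 - q := by linarith
  have hq0 : 0 < q := hp.trans_le hpq
  have ha : 0 < (1 - p) / (1 - q) := div_pos hp1 hq1
  refine ⟨fun u hu v hv ↦ ?_, by simp [sub_sub], ?_⟩
  · have hba : p / q ≤ (1 - p) / (1 - q) :=
      ((div_le_one hq0).2 hpq).trans ((one_le_div hq1).2 (by linarith))
    have hinner : ∀ x ∈ Ioo (0:ℝ) u, (∫ y in (0:ℝ)..v,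
          (if x ∈ Ioo (0:ℝ) 1 ∧ y ∈ Ioo (0:ℝ) 1 ∧
              x ^ ((1 - p) / (1 - q)) < y ∧ y ≤ x ^ (p / q)
            then (1 - p) * q * x ^ (-p) * y ^ (q - 1) else 0)) =
        (1 - p) * x ^ (-p) * (min (v ^ q) (x ^ p) -
          min (v ^ q) (x ^ ((1 - p) / (1 - q) * q))) := fun x hx ↦ by
      rw [integral_density_section hq0 (div_pos hp hq0) hba ⟨hx.1, hx.2.trans_le hu.2⟩ hv.1,
        div_mul_cancel₀ _ hq0.ne']
      field_simp
    have hcont : ∀ {r : ℝ}, 0 < r → Continuous fun x : ℝ ↦ x ^ r :=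
      fun hr ↦ Real.continuous_rpow_const hr.le
    have hint : IntervalIntegrable (fun x : ℝ ↦ (1 - p) * x ^ (-p) * (min (v ^ q) (x ^ p) -
        min (v ^ q) (x ^ ((1 - p) / (1 - q) * q)))) volume 0 u :=
      ((intervalIntegrable_rpow' (by linarith)).const_mul _).mul_continuousOn
        ((continuous_const.min (hcont hp)).sub
          (continuous_const.min (hcont (mul_pos ha hq0)))).continuousOn
    have hF : Continuous fun u : ℝ ↦ min (u ^ p) (v ^ q) * min (u ^ (1 - p)) (v ^ (1 - q)) -
        (p * min u (v ^ (q / p)) + (1 - q) * min (u ^ ((1 - p) / (1 - q))) v) :=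
      (((hcont hp).min continuous_const).mul ((hcont hp1).min continuous_const)).sub
        ((continuous_const.mul (continuous_id.min continuous_const)).add
          (continuous_const.mul ((hcont ha).min continuous_const)))
    have hftc := integral_eq_of_hasDerivAt_off_countable_of_le _ _ hu.1
      (s := {v ^ (q / p), v ^ ((1 - q) / (1 - p))}) (Set.toFinite _).countable
      hF.continuousOn (fun x hx ↦ by
        have hx' := hx.2
        simp only [mem_insert_iff, mem_singleton_iff, not_or] at hx'
        exact hasDerivAt_comonotonic_liebscher_sub_singular hp hpq hq hv hx.1.1 hx'.1 hx'.2) hint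
    have hzero : min ((0:ℝ) ^ p) (v ^ q) * min ((0:ℝ) ^ (1 - p)) (v ^ (1 - q)) -
        (p * min 0 (v ^ (q / p)) + (1 - q) * min ((0:ℝ) ^ ((1 - p) / (1 - q))) v) = 0 := by
      rw [Real.zero_rpow hp.ne', Real.zero_rpow hp1.ne', Real.zero_rpow ha.ne',
        min_eq_left (Real.rpow_nonneg hv.1 _), min_eq_left (Real.rpow_nonneg hv.1 _),
        min_eq_left (Real.rpow_nonneg hv.1 _), min_eq_left hv.1]
      ring
    rw [integral_of_le hu.1, integral_Ioc_eq_integral_Ioo,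
      setIntegral_congr_fun measurableSet_Ioo hinner, ← integral_Ioc_eq_integral_Ioo,
      ← integral_of_le hu.1, hftc, hzero]
    ring
  · rw [min_eq_left hpq, min_eq_right (by linarith)]
end

section
/- Let K ≥ 1 and p₁,…,p_K, q₁,…,q_K ∈ [0,1] with ∑_{k=1}^K p_k = ∑_{k=1}^K q_k = 1. Then Blomqvist's medial correlation coefficient of the comonotonic-based Liebscher copula satisfies β(C̃_CL) = 4·C̃_CL(1/2, 1/2) − 1 = 4·∏_{k=1}^K min(2^{−p_k}, 2^{−q_k}) − 1 = 2^{∑_{k=1}^K min(p_k, q_k)} − 1. -/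
open Set

theorem half_rpow_eq_two_rpow_neg (x : ℝ) : ((1:ℝ) / 2) ^ x = (2:ℝ) ^ (-x) := by
  rw [one_div, Real.inv_rpow zero_le_two, Real.rpow_neg zero_le_two]

theorem min_two_rpow_neg (x y : ℝ) :
    min ((2:ℝ) ^ (-x)) ((2:ℝ) ^ (-y)) = (2:ℝ) ^ (min x y - (x + y)) := by
  have hmono : Monotone fun t : ℝ => (2:ℝ) ^ t := fun _ _ h =>
    Real.rpow_le_rpow_of_exponent_le one_le_two h
  rw [← hmono.map_min, min_neg_neg, ← min_add_max x y]
  congr 1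
  ring

/-- **Blomqvist's medial correlation coefficient of the comonotonic-based Liebscher
copula.** For weights `p_k, q_k ∈ [0,1]` with `∑ p_k = ∑ q_k = 1`,
`β(C̃_CL) = 4·C̃_CL(1/2,1/2) − 1 = 4·∏_k min(2^{−p_k}, 2^{−q_k}) − 1
          = 2^{∑_k min(p_k,q_k)} − 1`. -/
theorem blomqvist_comonotonic_liebscher
    (K : ℕ) (hK : 1 ≤ K) (p q : Fin K → ℝ)
    (hp : ∀ k, p k ∈ Set.Icc (0:ℝ) 1) (hq : ∀ k, q k ∈ Set.Icc (0:ℝ) 1)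
    (hps : ∑ k, p k = 1) (hqs : ∑ k, q k = 1) :
    4 * (∏ k, min (((1:ℝ) / 2) ^ p k) (((1:ℝ) / 2) ^ q k)) - 1 =
        4 * (∏ k, min ((2:ℝ) ^ (-p k)) ((2:ℝ) ^ (-q k))) - 1 ∧
    4 * (∏ k, min (((1:ℝ) / 2) ^ p k) (((1:ℝ) / 2) ^ q k)) - 1 =
        2 ^ (∑ k, min (p k) (q k)) - 1 := by
  simp only [half_rpow_eq_two_rpow_neg, true_and]
  simp only [min_two_rpow_neg]
  rw [← Real.rpow_sum_of_pos two_pos, Finset.sum_sub_distrib, Finset.sum_add_distrib, hps, hqs,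
    Real.rpow_sub two_pos]
  norm_num
  ring
end

section
/- Let K ≥ 1 and p₁,…,p_K, q₁,…,q_K ∈ [0,1] with ∑_{k=1}^K p_k = ∑_{k=1}^K q_k = 1, and let C̃_CL(u,v) = ∏_{k=1}^K min(u^{p_k}, v^{q_k}). Then the tail dependence coefficients of C̃_CL are: (a) the upper tail coefficient λ_U(C̃_CL) = 2 − lim_{u→1⁻} (C̃_CL(u,u) − 1)/(u − 1) exists and equals ∑_{k=1}^K min(p_k, q_k); (b) the lower tail coefficient λ_L(C̃_CL) = lim_{u→0⁺} C̃_CL(u,u)/u exists and equals 1 if p_k = q_k for every k ∈ {1,…,K}, and equals 0 otherwise. -/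
open Set Filter
open scoped Classical

theorem prod_min_rpow_eq_rpow_sum_max {ι : Type*} (s : Finset ι) (p q : ι → ℝ) {u : ℝ}
    (hu₀ : 0 < u) (hu₁ : u ≤ 1) :
    ∏ k ∈ s, min (u ^ p k) (u ^ q k) = u ^ ∑ k ∈ s, max (p k) (q k) := by
  rw [Real.rpow_sum_of_pos hu₀]
  refine Finset.prod_congr rfl fun k _ => ?_
  rcases le_total (p k) (q k) with h | h
  · rw [max_eq_right h, min_eq_right (Real.rpow_le_rpow_of_exponent_ge hu₀ hu₁ h)]
  · rw [max_eq_left h, min_eq_left (Real.rpow_le_rpow_of_exponent_ge hu₀ hu₁ h)]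

theorem tendsto_rpow_sub_one_div_sub_one (s : ℝ) :
    Tendsto (fun u : ℝ => (u ^ s - 1) / (u - 1)) (nhdsWithin 1 (Iio 1)) (nhds s) := by
  have h := (Real.hasDerivAt_rpow_const (x := 1) (p := s) (Or.inl one_ne_zero)).tendsto_slope
  rw [Real.one_rpow, mul_one] at h
  refine (h.mono_left (nhdsWithin_mono _ fun u hu => ne_of_lt hu)).congr fun u => ?_
  rw [slope_def_field, Real.one_rpow]

theorem tendsto_rpow_div_self_nhdsGT_zero {s : ℝ} (hs : 1 < s) :
    Tendsto (fun u : ℝ => u ^ s / u) (nhdsWithin 0 (Ioi 0)) (nhds 0) := by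
  have h : Tendsto (fun u : ℝ => u ^ (s - 1)) (nhdsWithin 0 (Ioi 0)) (nhds 0) := by
    have hc := (Real.continuousAt_rpow_const 0 (s - 1) (Or.inr (by linarith))).tendsto
    rw [Real.zero_rpow (by linarith)] at hc
    exact hc.mono_left nhdsWithin_le_nhds
  refine h.congr' ?_
  filter_upwards [self_mem_nhdsWithin] with u hu
  rw [Real.rpow_sub_one (ne_of_gt hu)]

/-- **Tail dependence coefficients of the comonotonic-based Liebscher copula.**
For weights `p_k, q_k ∈ [0,1]` with `∑ p_k = ∑ q_k = 1` and
`C̃_CL(u,v) = ∏_k min(u^{p_k}, v^{q_k})`: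
(a) `λ_U(C̃_CL) = 2 − lim_{u→1⁻} (C̃_CL(u,u)−1)/(u−1)` exists and equals
`∑_k min(p_k,q_k)`, i.e. the limit equals `2 − ∑_k min(p_k,q_k)`;
(b) `λ_L(C̃_CL) = lim_{u→0⁺} C̃_CL(u,u)/u` exists and equals 1 if `p_k = q_k` for all `k`,
and 0 otherwise. -/
theorem comonotonic_liebscher_tail_coefficients
    (K : ℕ) (hK : 1 ≤ K) (p q : Fin K → ℝ)
    (hp : ∀ k, p k ∈ Set.Icc (0:ℝ) 1) (hq : ∀ k, q k ∈ Set.Icc (0:ℝ) 1)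
    (hps : ∑ k, p k = 1) (hqs : ∑ k, q k = 1) :
    Filter.Tendsto (fun u : ℝ => ((∏ k, min (u ^ p k) (u ^ q k)) - 1) / (u - 1))
        (nhdsWithin 1 (Set.Iio 1)) (nhds (2 - ∑ k, min (p k) (q k))) ∧
    Filter.Tendsto (fun u : ℝ => (∏ k, min (u ^ p k) (u ^ q k)) / u)
        (nhdsWithin 0 (Set.Ioi 0))
        (nhds (if ∀ k, p k = q k then (1:ℝ) else 0)) := by
  constructor
  · have hsum : ∑ k, max (p k) (q k) = 2 - ∑ k, min (p k) (q k) := by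
      have h : ∑ k, (min (p k) (q k) + max (p k) (q k)) = ∑ k, (p k + q k) :=
        Finset.sum_congr rfl fun k _ => min_add_max _ _
      rw [Finset.sum_add_distrib, Finset.sum_add_distrib, hps, hqs] at h
      linarith
    rw [← hsum]
    refine (tendsto_rpow_sub_one_div_sub_one _).congr' ?_
    filter_upwards [Ioo_mem_nhdsLT (zero_lt_one (α := ℝ))] with u hu
    rw [prod_min_rpow_eq_rpow_sum_max _ p q hu.1 hu.2.le]
  · have hdiag : (fun u : ℝ => u ^ (∑ k, max (p k) (q k)) / u) =ᶠ[nhdsWithin 0 (Ioi 0)]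
        fun u : ℝ => (∏ k, min (u ^ p k) (u ^ q k)) / u := by
      filter_upwards [Ioo_mem_nhdsGT (zero_lt_one (α := ℝ))] with u hu
      rw [prod_min_rpow_eq_rpow_sum_max _ p q hu.1 hu.2.le]
    refine Tendsto.congr' hdiag ?_
    split_ifs with h
    · have hsum : ∑ k, max (p k) (q k) = 1 := by
        rw [← hps]
        exact Finset.sum_congr rfl fun k _ => by rw [← h k, max_self]
      rw [hsum]
      refine tendsto_const_nhds.congr' ?_
      filter_upwards [self_mem_nhdsWithin] with u hu
      rw [Real.rpow_one, div_self (ne_of_gt hu)]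
    · refine tendsto_rpow_div_self_nhdsGT_zero ?_
      by_contra! hle
      have hpm : ∀ k ∈ Finset.univ, p k = max (p k) (q k) :=
        (Finset.sum_eq_sum_iff_of_le fun k _ => le_max_left _ _).1
          (le_antisymm (Finset.sum_le_sum fun k _ => le_max_left _ _) (hle.trans hps.ge))
      have hqm : ∀ k ∈ Finset.univ, q k = max (p k) (q k) :=
        (Finset.sum_eq_sum_iff_of_le fun k _ => le_max_right _ _).1
          (le_antisymm (Finset.sum_le_sum fun k _ => le_max_right _ _) (hle.trans hqs.ge))
      exact h fun k => (hpm k (Finset.mem_univ k)).trans (hqm k (Finset.mem_univ k)).symm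
end
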